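/- Let A ⊆ 2^ω × 2^ω. If player II has a winning strategy in the two-dimensional measure game G_2(0, A), then player II has a winning strategy in the measure game G(0, B), where B = {x ∈ 2^ω : player II has a winning strategy in G(0, A_x)} and A_x = {y ∈ 2^ω : (x,y) ∈ A}. -/

import Mathlib

open MeasureTheory

namespace MeasureGame

/-- Cantor space `2^ω`. -/
abbrev Cantor : Type := ℕ → Bool

/-- The basic cylinder set `N_t` determined by a finite binary string `t`. -/
def cyl (t : List Bool) : Set Cantor := {x | ∀ i : Fin t.length, x i.1 = t.get i}

/-- A round of the measure game: player I's pair of rationals, then player II's bit. -/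
abbrev GRound : Type := (ℚ × ℚ) × Bool

/-- A strategy for player I in the measure game. -/
abbrev StratI : Type := List GRound → ℚ × ℚ

/-- A strategy for player II in the measure game. -/
abbrev StratII : Type := List GRound → ℚ × ℚ → Bool

/-- A run of the measure game. -/
abbrev Run : Type := ℕ → GRound

/-- The history (list of completed rounds) before round `n`. -/
def hist (r : Run) (n : ℕ) : List GRound := (List.range n).map r

/-- Player II's bit at round `n`. -/
def bits (r : Run) (n : ℕ) : Bool := (r n).2

/-- The finite binary string of player II's first `n` bits. -/
def path (r : Run) (n : ℕ) : List Bool := (List.range n).map (bits r)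

/-- The value player I assigned at round `n` to the one-bit extension of the current path by `b`. -/
def valI (r : Run) (n : ℕ) (b : Bool) : ℚ := if b then (r n).1.2 else (r n).1.1

/-- The value selected by player II's move at round `n`. -/
def sel (r : Run) (n : ℕ) : ℚ := valI r n (bits r n)

/-- Legality requirements on the single value player I assigned to `path r n ++ [b]`:
it is nonnegative, at most `μ(N_{t⌢b})`, and strictly below it when the latter is positive. -/
def mOK (μ : Measure Cantor) (r : Run) (n : ℕ) (b : Bool) : Prop :=
  0 ≤ valI r n b ∧ ((valI r n b : ℝ) ≤ (μ (cyl (path r n ++ [b]))).toReal) ∧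
    (0 < (μ (cyl (path r n ++ [b]))).toReal → (valI r n b : ℝ) < (μ (cyl (path r n ++ [b]))).toReal)

/-- Player I's move at round `n` of a run is legal (for the game `G(s, ·)`). -/
def IOK (μ : Measure Cantor) (s : ℝ) (r : Run) : ℕ → Prop
  | 0 => mOK μ r 0 false ∧ mOK μ r 0 true ∧ s < ((r 0).1.1 : ℝ) + ((r 0).1.2 : ℝ)
  | (n + 1) => mOK μ r (n + 1) false ∧ mOK μ r (n + 1) true ∧
      (r (n + 1)).1.1 + (r (n + 1)).1.2 = sel r n

/-- Player II's move at round `n` of a run is legal: the selected value is nonzero. -/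
def IIOK (r : Run) (n : ℕ) : Prop := sel r n ≠ 0

/-- The run `r` is consistent with player I's strategy `σ`. -/
def ConsI (σ : StratI) (r : Run) : Prop := ∀ n, (r n).1 = σ (hist r n)

/-- The run `r` is consistent with player II's strategy `τ`. -/
def ConsII (τ : StratII) (r : Run) : Prop := ∀ n, (r n).2 = τ (hist r n) (r n).1

/-- Player II wins the run `r` of `G(s, A)`: either player I is the first to break a rule,
or all rules are followed and the sequence of II's bits belongs to `A`. -/
def IIWinsRun (μ : Measure Cantor) (s : ℝ) (A : Set Cantor) (r : Run) : Prop :=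
  (∃ n, (∀ m < n, IOK μ s r m ∧ IIOK r m) ∧ ¬ IOK μ s r n) ∨
    ((∀ n, IOK μ s r n ∧ IIOK r n) ∧ bits r ∈ A)

/-- Player I has a winning strategy in the measure game `G(s, A)`. -/
def WinsI (μ : Measure Cantor) (s : ℝ) (A : Set Cantor) : Prop :=
  ∃ σ : StratI, ∀ r : Run, ConsI σ r → ¬ IIWinsRun μ s A r

/-- Player II has a winning strategy in the measure game `G(s, A)`. -/
def WinsII (μ : Measure Cantor) (s : ℝ) (A : Set Cantor) : Prop :=
  ∃ τ : StratII, ∀ r : Run, ConsII τ r → IIWinsRun μ s A r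

/-- The outer measure `μ*(A) = inf {μ(U) : U open, A ⊆ U}`. -/
noncomputable def outerM (μ : Measure Cantor) (A : Set Cantor) : ℝ :=
  sInf {v : ℝ | ∃ U : Set Cantor, IsOpen U ∧ A ⊆ U ∧ v = (μ U).toReal}

/-- The inner measure `μ_*(A) = sup {μ(F) : F closed, F ⊆ A}`. -/
noncomputable def innerM (μ : Measure Cantor) (A : Set Cantor) : ℝ :=
  sSup {v : ℝ | ∃ F : Set Cantor, IsClosed F ∧ F ⊆ A ∧ v = (μ F).toReal}


/-! The two-dimensional measure game `G₂(s, A)` for `A ⊆ 2^ω × 2^ω`, played with respect to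
the product measure `μ × μ`. -/

/-- A round of the two-dimensional game: player I's quadruple of rationals (indexed by
`Bool × Bool`), then player II's pair of bits. -/
abbrev GRound2 : Type := ((Bool × Bool) → ℚ) × (Bool × Bool)

/-- A strategy for player I in the two-dimensional game. -/
abbrev StratI2 : Type := List GRound2 → ((Bool × Bool) → ℚ)

/-- A strategy for player II in the two-dimensional game. -/
abbrev StratII2 : Type := List GRound2 → ((Bool × Bool) → ℚ) → Bool × Bool

/-- A run of the two-dimensional game. -/
abbrev Run2 : Type := ℕ → GRound2

def hist2 (r : Run2) (n : ℕ) : List GRound2 := (List.range n).map r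

def bits2 (r : Run2) (n : ℕ) : Bool × Bool := (r n).2

def path2 (r : Run2) (n : ℕ) : List (Bool × Bool) := (List.range n).map (bits2 r)

/-- The rectangle `N_{u₀} × N_{u₁}` determined by `u ∈ (2 × 2)^{<ω}`. -/
def rect (u : List (Bool × Bool)) : Set (Cantor × Cantor) :=
  cyl (u.map Prod.fst) ×ˢ cyl (u.map Prod.snd)

def valI2 (r : Run2) (n : ℕ) (b : Bool × Bool) : ℚ := (r n).1 b

/-- The value selected by player II's move at round `n`. -/
def sel2 (r : Run2) (n : ℕ) : ℚ := valI2 r n (bits2 r n)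

def mOK2 (μ : Measure Cantor) (r : Run2) (n : ℕ) (b : Bool × Bool) : Prop :=
  0 ≤ valI2 r n b ∧
    ((valI2 r n b : ℝ) ≤ ((μ.prod μ) (rect (path2 r n ++ [b]))).toReal) ∧
    (0 < ((μ.prod μ) (rect (path2 r n ++ [b]))).toReal →
      (valI2 r n b : ℝ) < ((μ.prod μ) (rect (path2 r n ++ [b]))).toReal)

def IOK2 (μ : Measure Cantor) (s : ℝ) (r : Run2) : ℕ → Prop
  | 0 => (∀ b : Bool × Bool, mOK2 μ r 0 b) ∧ s < ∑ b : Bool × Bool, ((r 0).1 b : ℝ)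
  | (n + 1) => (∀ b : Bool × Bool, mOK2 μ r (n + 1) b) ∧
      (∑ b : Bool × Bool, (r (n + 1)).1 b) = sel2 r n

def IIOK2 (r : Run2) (n : ℕ) : Prop := sel2 r n ≠ 0

def ConsI2 (σ : StratI2) (r : Run2) : Prop := ∀ n, (r n).1 = σ (hist2 r n)

def ConsII2 (τ : StratII2) (r : Run2) : Prop := ∀ n, (r n).2 = τ (hist2 r n) (r n).1

/-- Player II wins the run `r` of `G₂(s, A)`: either player I is the first to break a rule,
or all rules are followed and the pair of coordinate sequences of II's moves lies in `A`. -/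
def IIWinsRun2 (μ : Measure Cantor) (s : ℝ) (A : Set (Cantor × Cantor)) (r : Run2) : Prop :=
  (∃ n, (∀ m < n, IOK2 μ s r m ∧ IIOK2 r m) ∧ ¬ IOK2 μ s r n) ∨
    ((∀ n, IOK2 μ s r n ∧ IIOK2 r n) ∧
      ((fun n => (bits2 r n).1, fun n => (bits2 r n).2) : Cantor × Cantor) ∈ A)

/-- Player I has a winning strategy in the two-dimensional game `G₂(s, A)`. -/
def WinsI2 (μ : Measure Cantor) (s : ℝ) (A : Set (Cantor × Cantor)) : Prop :=
  ∃ σ : StratI2, ∀ r : Run2, ConsI2 σ r → ¬ IIWinsRun2 μ s A r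

/-- Player II has a winning strategy in the two-dimensional game `G₂(s, A)`. -/
def WinsII2 (μ : Measure Cantor) (s : ℝ) (A : Set (Cantor × Cantor)) : Prop :=
  ∃ τ : StratII2, ∀ r : Run2, ConsII2 τ r → IIWinsRun2 μ s A r

/-! ### Proof: part 1, full measure gives a winning strategy for II -/

theorem mem_cyl_path (f : ℕ → Bool) (n : ℕ) (y : Cantor) :
    y ∈ cyl ((List.range n).map f) ↔ ∀ i < n, y i = f i := by
  simp only [cyl, Set.mem_ofPred_eq, List.get_eq_getElem, List.getElem_map, List.getElem_range]
  constructor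
  · intro h i hi
    exact h ⟨i, by simpa using hi⟩
  · intro h i
    exact h i.1 (by simpa using i.2)

theorem mem_cyl_path_snoc (f : ℕ → Bool) (n : ℕ) (b : Bool) (y : Cantor) :
    y ∈ cyl ((List.range n).map f ++ [b]) ↔ (∀ i < n, y i = f i) ∧ y n = b := by
  have e : (List.range n).map f ++ [b]
      = (List.range (n+1)).map (fun i => if i < n then f i else b) := by
    rw [List.range_succ, List.map_append]
    congr 1
    · apply List.map_congr_left
      intro i hi
      simp [List.mem_range.1 hi]
    · simp
  rw [e, mem_cyl_path]
  constructor
  · intro h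
    refine ⟨fun i hi => by simpa [hi] using h i (by omega), by simpa using h n (by omega)⟩
  · rintro ⟨h1, h2⟩ i hi
    by_cases hin : i < n
    · simp [hin, h1 i hin]
    · have : i = n := by omega
      subst this; simp [h2]

theorem open_cyl (U : Set Cantor) (hU : IsOpen U) (x : Cantor) (hx : x ∈ U) :
    ∃ n, ∀ y : Cantor, (∀ i < n, y i = x i) → y ∈ U := by
  obtain ⟨I, u, h1, h2⟩ := isOpen_pi_iff.1 hU x hx
  refine ⟨I.sup id + 1, fun y hy => h2 ?_⟩
  intro i hi
  have : i ≤ I.sup id := Finset.le_sup (f := id) hi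
  rw [hy i (by omega)]
  exact (h1 i hi).2

theorem measurableSet_cyl (t : List Bool) : MeasurableSet (cyl t) := by
  have : cyl t = ⋂ i : Fin t.length, (fun x : Cantor => x i.1) ⁻¹' {t.get i} := by
    ext x; simp [cyl]
  rw [this]
  exact MeasurableSet.iInter fun i => measurable_pi_apply _ (measurableSet_singleton _)

theorem path_succ (r : Run) (n : ℕ) : path r (n+1) = path r n ++ [bits r n] := by
  simp [path, List.range_succ]

theorem hist_snd (r : Run) (n : ℕ) : (hist r n).map Prod.snd = path r n := by
  simp only [hist, path, List.map_map]
  rfl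

theorem winsII_of_null (μ : Measure Cantor) [IsProbabilityMeasure μ] (A : Set Cantor)
    (hA : μ Aᶜ = 0) : WinsII μ 0 A := by
  classical
  have hU : ∀ m : ℚ, ∃ U : Set Cantor, 0 < m → (Aᶜ ⊆ U ∧ IsOpen U ∧ (μ U).toReal < m) := by
    intro m
    by_cases hm : 0 < m
    · have hm' : (0:ℝ) < m := by exact_mod_cast hm
      obtain ⟨U, h1, h2, h3⟩ := Set.exists_isOpen_lt_of_lt Aᶜ (ENNReal.ofReal (m:ℝ))
        (μ := μ) (by rw [hA]; exact ENNReal.ofReal_pos.2 hm')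
      exact ⟨U, fun _ => ⟨h1, h2, (ENNReal.lt_ofReal_iff_toReal_lt (measure_ne_top _ _)).1 h3⟩⟩
    · exact ⟨∅, fun h => absurd h hm⟩
  choose U hU using hU
  let fm : List GRound → ℚ × ℚ → ℚ := fun h q => match h with
    | [] => q.1 + q.2
    | a :: _ => a.1.1 + a.1.2
  let τ : StratII := fun h q =>
    if (μ (U (fm h q) ∩ cyl (h.map Prod.snd ++ [false]))).toReal < (q.1 : ℝ) then false else true
  refine ⟨τ, fun r hr => ?_⟩
  set m0 : ℚ := (r 0).1.1 + (r 0).1.2 with hm0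
  have hfm : ∀ n, fm (hist r n) (r n).1 = m0 := by
    intro n
    cases n with
    | zero => rfl
    | succ n => simp [fm, hist, List.range_succ_eq_map, hm0]
  have hτ : ∀ n, bits r n =
      if (μ (U m0 ∩ cyl (path r n ++ [false]))).toReal < ((r n).1.1 : ℝ) then false else true := by
    intro n
    have := hr n
    simp only [τ, hfm, hist_snd] at this
    exact this
  have hsplit : ∀ n, (μ (U m0 ∩ cyl (path r n ++ [false]))).toReal +
      (μ (U m0 ∩ cyl (path r n ++ [true]))).toReal ≤ (μ (U m0 ∩ cyl (path r n))).toReal := by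
    intro n
    rw [← ENNReal.toReal_add (measure_ne_top _ _) (measure_ne_top _ _)]
    apply ENNReal.toReal_mono (measure_ne_top _ _)
    rw [← measure_inter_add_diff (U m0 ∩ cyl (path r n)) (measurableSet_cyl (path r n ++ [false]))]
    apply add_le_add
    · apply measure_mono
      rintro y ⟨hy1, hy2⟩
      exact ⟨⟨hy1, (mem_cyl_path _ _ _).2 ((mem_cyl_path_snoc _ _ _ _).1 hy2).1⟩, hy2⟩
    · apply measure_mono
      rintro y ⟨hy1, hy2⟩
      have h2 := (mem_cyl_path_snoc _ _ _ _).1 hy2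
      refine ⟨⟨hy1, (mem_cyl_path _ _ _).2 h2.1⟩, fun h3 => ?_⟩
      have h4 := ((mem_cyl_path_snoc _ _ _ _).1 h3).2
      rw [h2.2] at h4
      simp at h4
  have hstep : ∀ n, (μ (U m0 ∩ cyl (path r n))).toReal < ((r n).1.1 : ℝ) + ((r n).1.2 : ℝ) →
      (μ (U m0 ∩ cyl (path r (n+1)))).toReal < (sel r n : ℝ) := by
    intro n hn
    have h1 := hτ n
    have h2 := hsplit n
    rw [path_succ]
    by_cases hc : (μ (U m0 ∩ cyl (path r n ++ [false]))).toReal < ((r n).1.1 : ℝ)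
    · rw [if_pos hc] at h1
      simpa [sel, valI, h1] using hc
    · rw [if_neg hc] at h1
      simp only [sel, valI, h1, if_true]
      linarith
  have hpos : IOK μ 0 r 0 → 0 < m0 := by
    intro h
    have := h.2.2
    exact_mod_cast this
  have hinv : ∀ n, (∀ k ≤ n, IOK μ 0 r k) →
      (μ (U m0 ∩ cyl (path r (n+1)))).toReal < (sel r n : ℝ) := by
    intro n
    induction n with
    | zero =>
      intro h
      apply hstep
      have h3 := (hU m0 (hpos (h 0 le_rfl))).2.2
      have : (μ (U m0 ∩ cyl (path r 0))).toReal ≤ (μ (U m0)).toReal :=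
        ENNReal.toReal_mono (measure_ne_top _ _) (measure_mono Set.inter_subset_left)
      rw [hm0] at h3 this ⊢
      push_cast at h3
      linarith
    | succ n ih =>
      intro h
      apply hstep
      have h3 := ih (fun k hk => h k (by omega))
      have h4 : (r (n + 1)).1.1 + (r (n + 1)).1.2 = sel r n := (h (n+1) le_rfl).2.2
      rw [← h4] at h3
      exact_mod_cast h3
  have hII : ∀ n, (∀ k ≤ n, IOK μ 0 r k) → IIOK r n := by
    intro n h h0
    have := hinv n h
    rw [h0] at this
    have h' : 0 ≤ (μ (U m0 ∩ cyl (path r (n+1)))).toReal := ENNReal.toReal_nonneg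
    simp at this
    linarith
  by_cases hall : ∀ n, IOK μ 0 r n
  · refine Or.inr ⟨fun n => ⟨hall n, hII n fun k _ => hall k⟩, ?_⟩
    by_contra hx
    obtain ⟨h1, h2, -⟩ := hU m0 (hpos (hall 0))
    obtain ⟨n, hn⟩ := open_cyl _ h2 _ (h1 hx)
    have h3 := hinv n (fun k _ => hall k)
    have h4 : U m0 ∩ cyl (path r (n+1)) = cyl (path r (n+1)) := by
      apply Set.inter_eq_right.2
      intro y hy
      exact hn y fun i hi => (mem_cyl_path _ _ _).1 hy i (by omega)
    rw [h4, path_succ] at h3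
    have h5 : mOK μ r n (bits r n) := by
      have := hall n
      cases n with
      | zero => cases hb : bits r 0 <;> [exact this.1; exact this.2.1]
      | succ n => cases hb : bits r (n+1) <;> [exact this.1; exact this.2.1]
    have h6 := h5.2.1
    simp only [sel] at h3
    linarith
  · push Not at hall
    left
    refine ⟨Nat.find hall, fun k hk => ?_, Nat.find_spec hall⟩
    have : ∀ j, j < Nat.find hall → IOK μ 0 r j := fun j hj => not_not.1 (Nat.find_min hall hj)
    exact ⟨this k hk, hII k fun j hj => this j (by omega)⟩

/-! ### Part 2: a winning strategy for II in the 2D game gives full measure -/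

theorem mem_rect_path (f : ℕ → Bool × Bool) (n : ℕ) (y : Cantor × Cantor) :
    y ∈ rect ((List.range n).map f) ↔ ∀ i < n, (y.1 i, y.2 i) = f i := by
  simp only [rect, List.map_map, Set.mem_prod, mem_cyl_path, Prod.ext_iff, Function.comp]
  grind

theorem mem_rect_path_snoc (f : ℕ → Bool × Bool) (n : ℕ) (b : Bool × Bool) (y : Cantor × Cantor) :
    y ∈ rect ((List.range n).map f ++ [b]) ↔
      (∀ i < n, (y.1 i, y.2 i) = f i) ∧ (y.1 n, y.2 n) = b := by
  simp only [rect, List.map_append, List.map_map, Set.mem_prod, List.map_cons, List.map_nil,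
    mem_cyl_path_snoc, Prod.ext_iff, Function.comp]
  grind

theorem path2_succ (r : Run2) (n : ℕ) : path2 r (n+1) = path2 r n ++ [bits2 r n] := by
  simp [path2, List.range_succ]

theorem hist2_congr {r r' : Run2} {n : ℕ} (h : ∀ k < n, r k = r' k) :
    hist2 r n = hist2 r' n := by
  apply List.map_congr_left
  intro i hi
  exact h i (List.mem_range.1 hi)

theorem path2_congr {r r' : Run2} {n : ℕ} (h : ∀ k < n, r k = r' k) :
    path2 r n = path2 r' n := by
  apply List.map_congr_left
  intro i hi
  simp only [bits2, h i (List.mem_range.1 hi)]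

/-- history generated by I's moves `Q` against `τ` -/
def genH (τ : StratII2) (Q : ℕ → ((Bool × Bool) → ℚ)) : ℕ → List GRound2
  | 0 => []
  | n + 1 => genH τ Q n ++ [(Q n, τ (genH τ Q n) (Q n))]

def genR (τ : StratII2) (Q : ℕ → ((Bool × Bool) → ℚ)) : Run2 :=
  fun n => (Q n, τ (genH τ Q n) (Q n))

theorem hist2_genR (τ : StratII2) (Q) (n : ℕ) : hist2 (genR τ Q) n = genH τ Q n := by
  induction n with
  | zero => rfl
  | succ n ih =>
    have : hist2 (genR τ Q) (n+1) = hist2 (genR τ Q) n ++ [genR τ Q n] := by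
      simp [hist2, List.range_succ]
    rw [this, ih]; rfl

theorem cons_genR (τ : StratII2) (Q) : ConsII2 τ (genR τ Q) := by
  intro n
  rw [hist2_genR]; rfl

theorem exists_restart (τ : StratII2) (r : Run2) (hr : ConsII2 τ r) (n : ℕ) (q) :
    ∃ r', ConsII2 τ r' ∧ (∀ k < n, r' k = r k) ∧ (r' n).1 = q := by
  refine ⟨genR τ (Function.update (fun k => (r k).1) n q), cons_genR _ _, ?_, ?_⟩
  · intro k
    induction k using Nat.strong_induction_on with
    | _ k ih =>
      intro hk
      have h1 := hist2_congr (n := k) (fun j hj => ih j hj (by omega))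
      rw [hist2_genR] at h1
      have hne : k ≠ n := by omega
      simp only [genR, h1, Function.update_of_ne hne]
      exact Prod.ext rfl (hr k).symm
  · simp [genR]

/-- current value at round `n` when the initial total is `ε` -/
def cur (ε : ℚ) (r : Run2) : ℕ → ℚ
  | 0 => ε
  | n + 1 => sel2 r n

def Leg (μ : Measure Cantor) (ε : ℚ) (r : Run2) (n : ℕ) : Prop :=
  (∀ b, mOK2 μ r n b) ∧ ∑ b, (r n).1 b = cur ε r n

theorem Leg.iok {μ : Measure Cantor} {ε : ℚ} (hε : 0 < ε) {r : Run2} {n : ℕ}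
    (h : Leg μ ε r n) : IOK2 μ 0 r n := by
  cases n with
  | zero =>
    refine ⟨h.1, ?_⟩
    have := h.2
    simp only [cur] at this
    rw [← this] at hε
    exact_mod_cast hε
  | succ n => exact h

theorem cur_congr {ε : ℚ} {r r' : Run2} {n : ℕ} (h : ∀ k < n, r k = r' k) :
    cur ε r n = cur ε r' n := by
  cases n with
  | zero => rfl
  | succ n => simp only [cur, sel2, valI2, bits2, h n (Nat.lt_succ_self n)]

theorem Leg.congr {μ : Measure Cantor} {ε : ℚ} {r r' : Run2} {n : ℕ}
    (h : ∀ k ≤ n, r k = r' k) (hl : Leg μ ε r n) : Leg μ ε r' n := by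
  have h' : ∀ k < n, r k = r' k := fun k hk => h k hk.le
  simpa only [Leg, mOK2, valI2, cur_congr h', path2_congr h', h n le_rfl] using hl

theorem IIOK2.congr {r r' : Run2} {n : ℕ} (h : r n = r' n) (hl : IIOK2 r n) : IIOK2 r' n := by
  simpa only [IIOK2, sel2, valI2, bits2, h] using hl

def Good (μ : Measure Cantor) (τ : StratII2) (ε : ℚ) (r : Run2) (n : ℕ) : Prop :=
  ConsII2 τ r ∧ ∀ k < n, Leg μ ε r k ∧ IIOK2 r k

theorem exists_c (v δ : ℝ) (hv : 0 ≤ v) (hδ : 0 < δ) :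
    ∃ c : ℚ, 0 ≤ c ∧ v - δ < c ∧ (c = 0 ∨ (c : ℝ) < v) := by
  by_cases h : v - δ < 0
  · exact ⟨0, le_rfl, by simpa using h, Or.inl rfl⟩
  · obtain ⟨c, h1, h2⟩ := exists_rat_btwn (show v - δ < v by linarith)
    refine ⟨c, ?_, h1, Or.inr h2⟩
    have : (0:ℝ) ≤ c := by linarith
    exact_mod_cast this

theorem exists_split (v : Bool × Bool → ℝ) (hv : ∀ b, 0 ≤ v b) (m : ℚ) (hm : 0 < m)
    (h : (m : ℝ) < ∑ b, v b) :
    ∃ q : Bool × Bool → ℚ, ∑ b, q b = m ∧ ∀ b, 0 ≤ q b ∧ (q b = 0 ∨ (q b : ℝ) < v b) := by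
  have hδ : 0 < (∑ b, v b - m) / 4 := by linarith
  choose c hc0 hc1 hc2 using fun b => exists_c (v b) _ (hv b) hδ
  have hsum : (m : ℝ) < ∑ b, (c b : ℝ) := by
    have h1 : ∑ b, (v b - (∑ b, v b - m) / 4) < ∑ b, (c b : ℝ) :=
      Finset.sum_lt_sum_of_nonempty ⟨(true, true), Finset.mem_univ _⟩ (fun b _ => hc1 b)
    rw [Finset.sum_sub_distrib] at h1
    simp only [Finset.sum_const, Finset.card_univ, Fintype.card_prod, Fintype.card_bool] at h1
    norm_num at h1
    linarith
  have hsum' : m < ∑ b, c b := by exact_mod_cast hsum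
  have hS : 0 < ∑ b, c b := hm.trans hsum'
  have hle : m / ∑ b, c b ≤ 1 := (div_le_one hS).2 hsum'.le
  refine ⟨fun b => c b * (m / ∑ b, c b), ?_, fun b => ⟨?_, ?_⟩⟩
  · rw [← Finset.sum_mul]
    field_simp
  · exact mul_nonneg (hc0 b) (div_nonneg hm.le hS.le)
  · rcases hc2 b with h0 | h0
    · left; simp [h0]
    · right
      have : c b * (m / ∑ b, c b) ≤ c b := mul_le_of_le_one_right (hc0 b) hle
      exact lt_of_le_of_lt (by exact_mod_cast this) h0

theorem Good.extend {μ : Measure Cantor} {A : Set (Cantor × Cantor)} {τ : StratII2}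
    (hτ : ∀ r : Run2, ConsII2 τ r → IIWinsRun2 μ 0 A r) {ε : ℚ} (hε : 0 < ε) {r : Run2} {n : ℕ}
    (hg : Good μ τ ε r n) (hl : Leg μ ε r n) : Good μ τ ε r (n+1) := by
  refine ⟨hg.1, fun k hk => ?_⟩
  by_cases hkn : k < n
  · exact hg.2 k hkn
  obtain rfl : k = n := by omega
  refine ⟨hl, ?_⟩
  rcases hτ r hg.1 with ⟨j, h1, h2⟩ | ⟨h, -⟩
  · by_cases hjk : k < j
    · exact (h1 k hjk).2
    · exfalso
      apply h2
      rcases lt_or_eq_of_le (not_lt.1 hjk) with h | h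
      · exact (hg.2 j h).1.iok hε
      · rw [h]; exact hl.iok hε
  · exact (h k).2

theorem step {μ : Measure Cantor} {A : Set (Cantor × Cantor)} {τ : StratII2}
    (hτ : ∀ r : Run2, ConsII2 τ r → IIWinsRun2 μ 0 A r) {ε : ℚ} (hε : 0 < ε) {r : Run2} {n : ℕ}
    (hg : Good μ τ ε r n) {δ : ℝ} (hδ : 0 < δ) :
    ∃ (w : Bool × Bool → ℝ) (ch : Bool × Bool → Option Run2),
      (∀ b, 0 ≤ w b) ∧ ∑ b, w b ≤ cur ε r n + δ ∧
      ∀ b, (ch b = none → ((μ.prod μ) (rect (path2 r n ++ [b]))).toReal ≤ w b) ∧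
        ∀ r', ch b = some r' → Good μ τ ε r' (n+1) ∧ (∀ k < n, r' k = r k) ∧
          bits2 r' n = b ∧ (cur ε r' (n+1) : ℝ) ≤ w b := by
  classical
  have hm : 0 < cur ε r n := by
    cases n with
    | zero => exact hε
    | succ n =>
      obtain ⟨h1, h2⟩ := hg.2 n (Nat.lt_succ_self n)
      exact lt_of_le_of_ne (h1.1 (bits2 r n)).1 (Ne.symm h2)
  let M : Bool × Bool → ℝ := fun b => ((μ.prod μ) (rect (path2 r n ++ [b]))).toReal
  have hM0 : ∀ b, 0 ≤ M b := fun b => ENNReal.toReal_nonneg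
  let P : Bool × Bool → Run2 → Prop := fun b r' =>
    Good μ τ ε r' (n+1) ∧ (∀ k < n, r' k = r k) ∧ bits2 r' n = b
  let S : Bool × Bool → Set ℝ := fun b =>
    insert (M b) {z | ∃ r', P b r' ∧ z = (cur ε r' (n+1) : ℝ)}
  have hS0 : ∀ b, ∀ z ∈ S b, 0 ≤ z := by
    rintro b z (rfl | ⟨r', ⟨h1, -, -⟩, rfl⟩)
    · exact hM0 b
    · have := ((h1.2 n (Nat.lt_succ_self n)).1.1 (bits2 r' n)).1
      exact_mod_cast this
  have hSne : ∀ b, (S b).Nonempty := fun b => ⟨M b, Set.mem_insert _ _⟩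
  have hSb : ∀ b, BddBelow (S b) := fun b => ⟨0, fun z hz => hS0 b z hz⟩
  have key : ∑ b, sInf (S b) ≤ cur ε r n := by
    by_contra hcon
    push Not at hcon
    obtain ⟨q, hq1, hq2⟩ := exists_split (fun b => sInf (S b))
      (fun b => Real.sInf_nonneg (hS0 b)) _ hm hcon
    obtain ⟨r', hr1, hr2, hr3⟩ := exists_restart τ r hg.1 n q
    have hgood : Good μ τ ε r' n := by
      refine ⟨hr1, fun k hk => ⟨(hg.2 k hk).1.congr fun j hj => (hr2 j (by omega)).symm,
        (hg.2 k hk).2.congr (hr2 k hk).symm⟩⟩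
    have hleg : Leg μ ε r' n := by
      refine ⟨fun b => ?_, ?_⟩
      · have hb : sInf (S b) ≤ M b := csInf_le (hSb b) (Set.mem_insert _ _)
        simp only [mOK2, valI2, hr3, path2_congr hr2]
        refine ⟨(hq2 b).1, ?_, fun hp => ?_⟩
        · rcases (hq2 b).2 with h | h
          · rw [h]; simp
          · exact (h.trans_le hb).le
        · rcases (hq2 b).2 with h | h
          · rw [h]; simpa using hp
          · exact h.trans_le hb
      · rw [hr3, hq1, cur_congr hr2]
    have hG := hgood.extend hτ hε hleg
    have hne : q (bits2 r' n) ≠ 0 := by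
      have := (hG.2 n (Nat.lt_succ_self n)).2
      simpa only [IIOK2, sel2, valI2, hr3] using this
    have hlt := (hq2 (bits2 r' n)).2.resolve_left hne
    have : sInf (S (bits2 r' n)) ≤ (q (bits2 r' n) : ℝ) := by
      apply csInf_le (hSb _)
      right
      refine ⟨r', ⟨hG, hr2, rfl⟩, ?_⟩
      simp only [cur, sel2, valI2, hr3]
    linarith
  have hex : ∀ b, ∃ z ∈ S b, z < sInf (S b) + δ / 4 := fun b =>
    exists_lt_of_csInf_lt (hSne b) (by linarith)
  choose w hwS hwlt using hex
  have hch : ∀ b, ∃ o : Option Run2, (o = none → M b ≤ w b) ∧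
      ∀ r', o = some r' → P b r' ∧ (cur ε r' (n+1) : ℝ) ≤ w b := by
    intro b
    rcases hwS b with h | ⟨r', h1, h2⟩
    · exact ⟨none, fun _ => h.ge, fun r' h => by simp at h⟩
    · refine ⟨some r', fun h => by simp at h, fun r'' h => ?_⟩
      obtain rfl : r' = r'' := by simpa using h
      exact ⟨h1, h2.ge⟩
  choose ch hch using hch
  refine ⟨w, ch, fun b => hS0 b _ (hwS b), ?_, fun b => ⟨(hch b).1, fun r' h => ?_⟩⟩
  · have h1 : ∑ b, w b ≤ ∑ b, (sInf (S b) + δ / 4) := Finset.sum_le_sum fun b _ => (hwlt b).le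
    rw [Finset.sum_add_distrib] at h1
    simp only [Finset.sum_const, Finset.card_univ, Fintype.card_prod, Fintype.card_bool] at h1
    norm_num at h1
    linarith
  · obtain ⟨⟨a, b, c⟩, d⟩ := (hch b).2 r' h
    exact ⟨a, b, c, d⟩

def Die (ch : Run2 → ℕ → Bool × Bool → Option Run2) (x : Cantor × Cantor) : ℕ → Run2 → ℕ → Prop
  | 0, _, _ => False
  | N + 1, r, n => ∀ r', ch r n (x.1 n, x.2 n) = some r' → Die ch x N r' (n+1)

theorem Die.mono {ch} {x : Cantor × Cantor} {N : ℕ} : ∀ {r : Run2} {n : ℕ},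
    Die ch x N r n → Die ch x (N+1) r n := by
  induction N with
  | zero => intro r n h; exact h.elim
  | succ N ih => intro r n h r' hr'; exact ih (h r' hr')

theorem measure_compl_le {μ : Measure Cantor} [IsProbabilityMeasure μ]
    {A : Set (Cantor × Cantor)} {τ : StratII2}
    (hτ : ∀ r : Run2, ConsII2 τ r → IIWinsRun2 μ 0 A r) {ε : ℚ} (hε : 0 < ε) :
    (μ.prod μ) Aᶜ ≤ ENNReal.ofReal (3 * ε) := by
  classical
  have hεR : (0:ℝ) < ε := by exact_mod_cast hε
  have hstep : ∀ (r : Run2) (n : ℕ), ∃ (w : Bool × Bool → ℝ) (ch : Bool × Bool → Option Run2),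
      Good μ τ ε r n → (∀ b, 0 ≤ w b) ∧ ∑ b, w b ≤ cur ε r n + ε * (1/8)^n ∧
      ∀ b, (ch b = none → ((μ.prod μ) (rect (path2 r n ++ [b]))).toReal ≤ w b) ∧
        ∀ r', ch b = some r' → Good μ τ ε r' (n+1) ∧ (∀ k < n, r' k = r k) ∧
          bits2 r' n = b ∧ (cur ε r' (n+1) : ℝ) ≤ w b := by
    intro r n
    by_cases hg : Good μ τ ε r n
    · obtain ⟨w, ch, h⟩ := step hτ hε hg (δ := ε * (1/8)^n) (by positivity)
      exact ⟨w, ch, fun _ => h⟩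
    · exact ⟨0, fun _ => none, fun h => absurd h hg⟩
  choose w ch hstep using hstep
  have hE : ∀ N r n, Good μ τ ε r n →
      (μ.prod μ) {x | x ∈ rect (path2 r n) ∧ Die ch x N r n}
        ≤ ENNReal.ofReal (cur ε r n + 2 * ε * (1/8)^n) := by
    intro N
    induction N with
    | zero => intro r n _; simp [Die]
    | succ N ih =>
      intro r n hg
      obtain ⟨hw0, hws, hb⟩ := hstep r n hg
      let T : Bool × Bool → Set (Cantor × Cantor) := fun b =>
        {x | x ∈ rect (path2 r n ++ [b]) ∧ ∀ r', ch r n b = some r' → Die ch x N r' (n+1)}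
      have hsub : {x | x ∈ rect (path2 r n) ∧ Die ch x (N+1) r n} ⊆ ⋃ b, T b := by
        rintro x ⟨h1, h2⟩
        refine Set.mem_iUnion.2 ⟨(x.1 n, x.2 n), ?_, h2⟩
        exact (mem_rect_path_snoc _ _ _ _).2 ⟨(mem_rect_path _ _ _).1 h1, rfl⟩
      have hT : ∀ b, (μ.prod μ) (T b) ≤ ENNReal.ofReal (w r n b + 2 * ε * (1/8)^(n+1)) := by
        intro b
        have hp : 0 ≤ 2 * (ε:ℝ) * (1/8)^(n+1) := by positivity
        cases hc : ch r n b with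
        | none =>
          have h1 : (μ.prod μ) (T b) ≤ (μ.prod μ) (rect (path2 r n ++ [b])) :=
            measure_mono fun x hx => hx.1
          refine h1.trans ?_
          rw [← ENNReal.ofReal_toReal (measure_ne_top (μ.prod μ) (rect (path2 r n ++ [b])))]
          apply ENNReal.ofReal_le_ofReal
          have := (hb b).1 hc
          linarith
        | some r' =>
          obtain ⟨g1, g2, g3, g4⟩ := (hb b).2 r' hc
          have h1 : T b ⊆ {x | x ∈ rect (path2 r' (n+1)) ∧ Die ch x N r' (n+1)} := by
            rintro x ⟨h1, h2⟩
            refine ⟨?_, h2 r' hc⟩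
            rw [path2_succ, g3, path2_congr g2]
            exact h1
          refine (measure_mono h1).trans ((ih r' (n+1) g1).trans ?_)
          apply ENNReal.ofReal_le_ofReal
          linarith
      refine (measure_mono hsub).trans ((measure_iUnion_fintype_le _ _).trans ?_)
      refine (Finset.sum_le_sum fun b _ => hT b).trans ?_
      rw [← ENNReal.ofReal_sum_of_nonneg
        (fun b _ => add_nonneg (hw0 b) (by positivity))]
      apply ENNReal.ofReal_le_ofReal
      rw [Finset.sum_add_distrib]
      simp only [Finset.sum_const, Finset.card_univ, Fintype.card_prod, Fintype.card_bool]
      norm_num [pow_succ] at hws ⊢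
      linarith
  let r0 : Run2 := genR τ 0
  have hg0 : Good μ τ ε r0 0 := ⟨cons_genR _ _, fun k hk => absurd hk (Nat.not_lt_zero k)⟩
  have hcover : Aᶜ ⊆ ⋃ N, {x | x ∈ rect (path2 r0 0) ∧ Die ch x N r0 0} := by
    intro x hxA
    by_contra hnot
    apply hxA
    have hnd : ∀ N, ¬ Die ch x N r0 0 := by
      intro N hN
      exact hnot (Set.mem_iUnion.2 ⟨N, (mem_rect_path _ _ _).2 (by simp), hN⟩)
    let X : ℕ → Bool × Bool := fun n => (x.1 n, x.2 n)
    let node : ℕ → Run2 := fun n =>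
      Nat.rec r0 (fun n r => (ch r n (X n)).getD r) n
    have hnode : ∀ n, node (n+1) = (ch (node n) n (X n)).getD (node n) := fun n => rfl
    have hnd' : ∀ n, (∀ N, ¬ Die ch x N (node n) n) → 
        ∃ r', ch (node n) n (X n) = some r' ∧ ∀ N, ¬ Die ch x N r' (n+1) := by
      intro n h
      cases hc : ch (node n) n (X n) with
      | none =>
        exfalso
        apply h 1
        intro r' hr'
        have : ch (node n) n (X n) = some r' := hr'
        rw [hc] at this
        simp at this
      | some r' =>
        refine ⟨r', rfl, fun N hN => h (N+1) ?_⟩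
        intro r'' hr''
        have : ch (node n) n (X n) = some r'' := hr''
        rw [hc] at this
        obtain rfl : r' = r'' := by simpa using this
        exact hN
    have hinv : ∀ n, Good μ τ ε (node n) n ∧ ∀ N, ¬ Die ch x N (node n) n := by
      intro n
      induction n with
      | zero => exact ⟨hg0, hnd⟩
      | succ n ih =>
        obtain ⟨r', h1, h2⟩ := hnd' n ih.2
        rw [hnode, h1]
        exact ⟨(((hstep _ _ ih.1).2.2 (X n)).2 r' h1).1, h2⟩
    have hnext : ∀ n, (∀ k < n, node (n+1) k = node n k) ∧ bits2 (node (n+1)) n = X n := by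
      intro n
      obtain ⟨r', h1, h2⟩ := hnd' n (hinv n).2
      rw [hnode, h1]
      have := ((hstep _ _ (hinv n).1).2.2 (X n)).2 r' h1
      exact ⟨this.2.1, this.2.2.1⟩
    let R : Run2 := fun n => node (n+1) n
    have hagree : ∀ m k, k < m → node m k = R k := by
      intro m
      induction m with
      | zero => intro k hk; omega
      | succ m ih =>
        intro k hk
        by_cases h : k < m
        · rw [(hnext m).1 k h, ih k h]
        · obtain rfl : k = m := by omega
          rfl
    have hcons : ConsII2 τ R := by
      intro n
      have := (hinv (n+1)).1.1 n
      rw [hist2_congr (fun k hk => hagree (n+1) k (by omega))] at this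
      exact this
    have hok : ∀ n, IOK2 μ 0 R n ∧ IIOK2 R n := by
      intro n
      obtain ⟨h1, h2⟩ := (hinv (n+1)).1.2 n (Nat.lt_succ_self n)
      exact ⟨(h1.congr fun k hk => hagree (n+1) k (by omega)).iok hε, h2.congr rfl⟩
    have hbits : ∀ n, bits2 R n = X n := fun n => (hnext n).2
    rcases hτ R hcons with ⟨n, -, h⟩ | ⟨-, h⟩
    · exact absurd (hok n).1 h
    · simpa only [hbits, X] using h
  refine (measure_mono hcover).trans ?_
  rw [Monotone.measure_iUnion]
  · refine iSup_le fun N => (hE N r0 0 hg0).trans ?_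
    apply ENNReal.ofReal_le_ofReal
    simp only [cur, pow_zero]
    linarith
  · apply monotone_nat_of_le_succ
    rintro N x ⟨h1, h2⟩
    exact ⟨h1, h2.mono⟩

theorem null_of_winsII2 {μ : Measure Cantor} [IsProbabilityMeasure μ]
    {A : Set (Cantor × Cantor)} (h : WinsII2 μ 0 A) : (μ.prod μ) Aᶜ = 0 := by
  obtain ⟨τ, hτ⟩ := h
  by_contra hne
  have hpos : 0 < ((μ.prod μ) Aᶜ).toReal :=
    ENNReal.toReal_pos hne (measure_ne_top _ _)
  obtain ⟨ε, h1, h2⟩ := exists_rat_btwn (show (0:ℝ) < ((μ.prod μ) Aᶜ).toReal / 3 by positivity)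
  have h3 := measure_compl_le hτ (ε := ε) (by exact_mod_cast h1)
  have h4 := ENNReal.toReal_le_of_le_ofReal (by positivity) h3
  linarith

/-- If player II wins the two-dimensional game `G₂(0, A)`, then player II wins `G(0, B)`,
where `B` is the set of `x` such that player II wins `G(0, A_x)`. -/
theorem winsII_sections_of_winsII2 (μ : Measure Cantor) [IsProbabilityMeasure μ]
    (A : Set (Cantor × Cantor)) (h : WinsII2 μ 0 A) :
    WinsII μ 0 {x : Cantor | WinsII μ 0 {y : Cantor | (x, y) ∈ A}} := by
  have h0 := null_of_winsII2 h
  apply winsII_of_null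
  have h1 := Measure.measure_ae_null_of_prod_null h0
  refine measure_mono_null ?_ (ae_iff.1 h1)
  intro x hx hx0
  exact hx (winsII_of_null μ _ hx0)

end MeasureGame
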